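/- arXiv:2504.08023 — 2 statements merged into one kernel-verified Lean document; each statement's English description precedes it below -/
import Mathlib

section
/- Let m be a natural number such that 8m+7 is prime and φ(6m+5) = 4m+4. Then for every ℓ ≥ 1, both n = 2^ℓ·(8m+7) and n = 2^ℓ·(6m+5) satisfy φ(n) + φ(n + φ(n)) = n; moreover g(2^ℓ·(8m+7)) = 2^{ℓ+1}·(6m+5) and g(2^{ℓ+1}·(6m+5)) = 2^{ℓ+1}·(8m+7). -/
def g (n : ℕ) : ℕ := n + Nat.totient n

theorem totient_two_pow_succ_mul_of_odd {a : ℕ} (ha : Odd a) (k : ℕ) :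
    Nat.totient (2 ^ (k + 1) * a) = 2 ^ k * Nat.totient a := by
  rw [Nat.totient_mul (Nat.Coprime.pow_left _ (Nat.coprime_two_left.2 ha)),
    Nat.totient_prime_pow_succ Nat.prime_two]
  simp

theorem stmt_17 (m : ℕ) (hp : Nat.Prime (8 * m + 7))
    (hφ : Nat.totient (6 * m + 5) = 4 * m + 4) :
    ∀ ℓ : ℕ, 1 ≤ ℓ →
      (Nat.totient (2 ^ ℓ * (8 * m + 7)) +
        Nat.totient (2 ^ ℓ * (8 * m + 7) + Nat.totient (2 ^ ℓ * (8 * m + 7))) =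
          2 ^ ℓ * (8 * m + 7)) ∧
      (Nat.totient (2 ^ ℓ * (6 * m + 5)) +
        Nat.totient (2 ^ ℓ * (6 * m + 5) + Nat.totient (2 ^ ℓ * (6 * m + 5))) =
          2 ^ ℓ * (6 * m + 5)) ∧
      g (2 ^ ℓ * (8 * m + 7)) = 2 ^ (ℓ + 1) * (6 * m + 5) ∧
      g (2 ^ (ℓ + 1) * (6 * m + 5)) = 2 ^ (ℓ + 1) * (8 * m + 7) := by
  have totient_p (k : ℕ) :
      Nat.totient (2 ^ (k + 1) * (8 * m + 7)) = 2 ^ (k + 1) * (4 * m + 3) := by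
    rw [totient_two_pow_succ_mul_of_odd ⟨4 * m + 3, by ring⟩, Nat.totient_prime hp,
      show 8 * m + 7 - 1 = 2 * (4 * m + 3) by omega]
    ring
  have totient_q (k : ℕ) :
      Nat.totient (2 ^ (k + 1) * (6 * m + 5)) = 2 ^ (k + 1) * (2 * m + 2) := by
    rw [totient_two_pow_succ_mul_of_odd ⟨3 * m + 2, by ring⟩, hφ]
    ring
  have g_p (k : ℕ) : g (2 ^ (k + 1) * (8 * m + 7)) = 2 ^ (k + 2) * (6 * m + 5) := by
    rw [g, totient_p]
    ring
  have g_q (k : ℕ) : g (2 ^ (k + 1) * (6 * m + 5)) = 2 ^ (k + 1) * (8 * m + 7) := by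
    rw [g, totient_q]
    ring
  intro ℓ hℓ
  obtain ⟨k, rfl⟩ := Nat.exists_eq_add_of_le' hℓ
  refine ⟨?_, ?_, g_p k, g_q (k + 1)⟩
  · rw [← g, g_p, totient_p, totient_q]
    ring
  · rw [← g, g_q, totient_q, totient_p]
    ring
end

section
/- For every k ≥ 0 one has g_{k+2}(10) = 2·g_k(10) and g_{k+2}(94) = 2·g_k(94). -/
theorem g_two_mul_of_even {n : ℕ} (hn : Even n) : g (2 * n) = 2 * g n := by
  rw [g, g, Nat.totient_mul_of_prime_of_dvd Nat.prime_two hn.two_dvd, mul_add]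

theorem iterate_g_add_two {n : ℕ} (hn : Even n) (hgn : Even (g n)) (h : g (g n) = 2 * n)
    (k : ℕ) : g^[k + 2] n = 2 * g^[k] n := by
  induction k generalizing n with
  | zero => exact h
  | succ k ih =>
    refine ih hgn ?_ ?_
    · rw [h]
      exact even_two_mul n
    · rw [h, g_two_mul_of_even hn]

theorem stmt_18 (k : ℕ) :
    g^[k + 2] 10 = 2 * g^[k] 10 ∧ g^[k + 2] 94 = 2 * g^[k] 94 := by
  have h10 : g 10 = 14 := by decide +kernel
  have h14 : g 14 = 20 := by decide +kernel
  have h94 : g 94 = 140 := by decide +kernel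
  have h140 : g 140 = 188 := by decide +kernel
  exact ⟨iterate_g_add_two (by decide) (by rw [h10]; decide) (by rw [h10, h14]) k,
    iterate_g_add_two (by decide) (by rw [h94]; decide) (by rw [h94, h140]) k⟩
end
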